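/- Let (Ω, μ) be a finite measure space, let γ₊ > γ₋ ≥ 2 and C₀ > 0, and set ρ₊ := C₀^{1/γ₊} and ρ₋ := C₀^{1/γ₋} (so that ρ₊^{γ₊} = ρ₋^{γ₋}). Then there exists a constant c > 0, depending only on γ₊, γ₋ and C₀, such that the following holds. Let α₊ᵉ : Ω → [0,1] and ρ₊ᵉ, ρ₋ᵉ : Ω → [0,∞) be measurable with (ρ₊ᵉ)^{γ₊} = (ρ₋ᵉ)^{γ₋} a.e., set α₋ᵉ := 1 − α₊ᵉ, and assume (ρ±ᵉ)^{γ±} are integrable. Then c·∫ |ρ₊ᵉ − ρ₊|² dμ ≤ ∫ α₊ᵉ·H_{γ₊}(ρ₊ᵉ | ρ₊) dμ + ∫ α₋ᵉ·H_{γ₋}(ρ₋ᵉ | ρ₋) dμ. -/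

import Mathlib

open MeasureTheory

/-- Relative internal energy (Bregman divergence of `ρ ↦ ρ^γ/(γ-1)`):
`H_γ(ρ | r) = (ρ^γ - r^γ - γ r^(γ-1) (ρ - r)) / (γ - 1)`, with real powers. -/
noncomputable def Hrel (γ ρ r : ℝ) : ℝ :=
  (ρ ^ γ - r ^ γ - γ * r ^ (γ - 1) * (ρ - r)) / (γ - 1)

/-- Second-order Bernoulli inequality for real exponents `γ ≥ 2`. -/
theorem half_mul_sq_sub_one_le_rpow {γ t : ℝ} (hγ : 2 ≤ γ) (ht : 0 ≤ t) :
    γ / 2 * (t - 1) ^ 2 ≤ t ^ γ - 1 - γ * (t - 1) := by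
  have h := one_add_mul_self_le_rpow_one_add (s := t ^ 2 - 1) (by nlinarith [sq_nonneg t])
    (p := γ / 2) (by linarith)
  have e : (1 + (t ^ 2 - 1)) ^ (γ / 2) = t ^ γ := by
    rw [add_sub_cancel, ← Real.rpow_natCast, ← Real.rpow_mul ht]
    congr 1
    push_cast
    ring
  rw [e] at h
  linarith

theorem Hrel_lower_bound {γ x r : ℝ} (hγ : 2 ≤ γ) (hx : 0 ≤ x) (hr : 0 < r) :
    r ^ γ / 2 * (x / r - 1) ^ 2 ≤ Hrel γ x r := by
  have h := half_mul_sq_sub_one_le_rpow hγ (div_nonneg hx hr.le)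
  have hrγ : 0 < r ^ γ := Real.rpow_pos_of_pos hr γ
  have e : x ^ γ - r ^ γ - γ * r ^ (γ - 1) * (x - r)
      = r ^ γ * ((x / r) ^ γ - 1 - γ * (x / r - 1)) := by
    rw [Real.div_rpow hx hr.le, Real.rpow_sub_one hr.ne']
    field_simp
  rw [Hrel, e, le_div_iff₀ (by linarith)]
  have h2 := mul_le_mul_of_nonneg_left h hrγ.le
  have h3 := mul_nonneg hrγ.le (sq_nonneg (x / r - 1))
  linarith

theorem sq_sub_one_le_of_rpow_eq {a b p m : ℝ} (ha : 0 ≤ a) (hb : 0 ≤ b) (hm : 0 < m)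
    (hmp : m ≤ p) (h : a ^ p = b ^ m) : (a - 1) ^ 2 ≤ (b - 1) ^ 2 := by
  rcases le_total 1 a with h1 | h1
  · have h2 : a ≤ b := (Real.rpow_le_rpow_iff ha hb hm).1
      (h ▸ Real.rpow_le_rpow_of_exponent_le h1 hmp)
    nlinarith
  · have h2 : b ≤ a := (Real.rpow_le_rpow_iff hb ha hm).1 (by
      rw [← h]
      rcases ha.eq_or_lt with rfl | h0
      · rw [Real.zero_rpow hm.ne', Real.zero_rpow (by linarith)]
      · exact Real.rpow_le_rpow_of_exponent_ge h0 h1 hmp)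
    nlinarith

theorem integrable_mul_Hrel {Ω : Type*} [MeasurableSpace Ω] {μ : Measure Ω} [IsFiniteMeasure μ]
    {γ r : ℝ} {α ρ : Ω → ℝ} (hγ : 1 ≤ γ) (hα : Measurable α) (hρ : Measurable ρ)
    (hα01 : ∀ x, α x ∈ Set.Icc (0 : ℝ) 1) (hρ0 : ∀ x, 0 ≤ ρ x)
    (hint : Integrable (fun x => ρ x ^ γ) μ) :
    Integrable (fun x => α x * Hrel γ (ρ x) r) μ := by
  have hρint : Integrable ρ μ := by
    refine ((integrable_const (1 : ℝ)).add hint).mono' hρ.aestronglyMeasurable (.of_forall ?_)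
    intro x
    rw [Real.norm_of_nonneg (hρ0 x), Pi.add_apply]
    rcases le_total (ρ x) 1 with h | h
    · linarith [Real.rpow_nonneg (hρ0 x) γ]
    · linarith [Real.self_le_rpow_of_one_le h hγ]
  refine Integrable.bdd_mul (c := 1) ?_ hα.aestronglyMeasurable (.of_forall fun x => ?_)
  · exact ((hint.sub (integrable_const _)).sub
      ((hρint.sub (integrable_const _)).const_mul _)).div_const _
  · rw [Real.norm_of_nonneg (hα01 x).1]
    exact (hα01 x).2

theorem Hrel_mix_lower_bound {γp γm C0 a x y : ℝ} (hγm : 2 ≤ γm) (hγ : γm ≤ γp) (hC0 : 0 < C0)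
    (ha : a ∈ Set.Icc (0 : ℝ) 1) (hx : 0 ≤ x) (hy : 0 ≤ y) (hxy : x ^ γp = y ^ γm) :
    C0 / (2 * (C0 ^ (1 / γp)) ^ 2) * |x - C0 ^ (1 / γp)| ^ 2 ≤
      a * Hrel γp x (C0 ^ (1 / γp)) + (1 - a) * Hrel γm y (C0 ^ (1 / γm)) := by
  have hrpow : ∀ g : ℝ, 2 ≤ g → (C0 ^ (1 / g)) ^ g = C0 := fun g hg => by
    rw [← Real.rpow_mul hC0.le, one_div_mul_cancel (by linarith), Real.rpow_one]
  have er := hrpow γp (by linarith)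
  have es := hrpow γm hγm
  have hr : 0 < C0 ^ (1 / γp) := Real.rpow_pos_of_pos hC0 _
  have hs : 0 < C0 ^ (1 / γm) := Real.rpow_pos_of_pos hC0 _
  set r := C0 ^ (1 / γp)
  set s := C0 ^ (1 / γm)
  have h1 := Hrel_lower_bound (γ := γp) (by linarith) hx hr
  have h2 := Hrel_lower_bound hγm hy hs
  have h3 : (x / r - 1) ^ 2 ≤ (y / s - 1) ^ 2 :=
    sq_sub_one_le_of_rpow_eq (div_nonneg hx hr.le) (div_nonneg hy hs.le) (by linarith) hγ
      (by rw [Real.div_rpow hx hr.le, Real.div_rpow hy hs.le, hxy, er, es])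
  rw [er] at h1
  rw [es] at h2
  have h4 : C0 / 2 * (x / r - 1) ^ 2 ≤ Hrel γm y s :=
    (mul_le_mul_of_nonneg_left h3 (by positivity)).trans h2
  have e : C0 / (2 * r ^ 2) * |x - r| ^ 2 = C0 / 2 * (x / r - 1) ^ 2 := by
    rw [sq_abs]
    field_simp
  rw [e]
  have h5 := mul_le_mul_of_nonneg_left h1 ha.1
  have h6 := mul_le_mul_of_nonneg_left h4 (sub_nonneg.2 ha.2)
  linarith

/-- Coercivity of the potential part of the relative entropy:
with equal pressures `(ρ₊ᵉ)^{γ₊} = (ρ₋ᵉ)^{γ₋}` a.e. and `α₋ᵉ = 1 - α₊ᵉ`, one has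
`c ∫ |ρ₊ᵉ - ρ₊|² ≤ ∫ α₊ᵉ H_{γ₊}(ρ₊ᵉ|ρ₊) + ∫ α₋ᵉ H_{γ₋}(ρ₋ᵉ|ρ₋)`,
where `ρ₊ = C₀^{1/γ₊}`, `ρ₋ = C₀^{1/γ₋}` and `c` depends only on `γ₊, γ₋, C₀`. -/
theorem entropy_coercivity
    (γp γm C0 : ℝ) (hγm : 2 ≤ γm) (hγ : γm < γp) (hC0 : 0 < C0) :
    ∃ c > 0, ∀ (Ω : Type) (_ : MeasurableSpace Ω) (μ : Measure Ω)
      (_ : IsFiniteMeasure μ) (αpe ρpe ρme : Ω → ℝ),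
      Measurable αpe → Measurable ρpe → Measurable ρme →
      (∀ x, αpe x ∈ Set.Icc (0 : ℝ) 1) →
      (∀ x, 0 ≤ ρpe x) → (∀ x, 0 ≤ ρme x) →
      (∀ᵐ x ∂μ, ρpe x ^ γp = ρme x ^ γm) →
      Integrable (fun x => ρpe x ^ γp) μ → Integrable (fun x => ρme x ^ γm) μ →
      c * ∫ x, |ρpe x - C0 ^ (1 / γp)| ^ 2 ∂μ ≤
        ∫ x, αpe x * Hrel γp (ρpe x) (C0 ^ (1 / γp)) ∂μ +
        ∫ x, (1 - αpe x) * Hrel γm (ρme x) (C0 ^ (1 / γm)) ∂μ := by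
  refine ⟨C0 / (2 * (C0 ^ (1 / γp)) ^ 2), by positivity, ?_⟩
  intro Ω _ μ _ α ρp ρm hα hρp hρm hα01 hρp0 hρm0 hpress hip him
  have hp := integrable_mul_Hrel (r := C0 ^ (1 / γp)) (by linarith) hα hρp hα01 hρp0 hip
  have hm := integrable_mul_Hrel (α := fun x => 1 - α x) (r := C0 ^ (1 / γm)) (by linarith)
    (hα.const_sub 1) hρm
    (fun x => ⟨sub_nonneg.2 (hα01 x).2, sub_le_self _ (hα01 x).1⟩) hρm0 him
  rw [← integral_const_mul, ← integral_add hp hm]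
  refine integral_mono_of_nonneg (.of_forall fun x => ?_) (hp.add hm) ?_
  · simp only [Pi.zero_apply]
    positivity
  · filter_upwards [hpress] with x hx
    exact Hrel_mix_lower_bound hγm hγ.le hC0 (hα01 x) (hρp0 x) (hρm0 x) hx
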